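/- Set H := B + 2(1+D) in R. Every element x of R can be written uniquely in the form x = b·D + f(A) + H·g(A), i.e., there exist an integer b and polynomials f, g ∈ ℤ[t] with x = b·D + f(A) + H·g(A) in R, and if b·D + f(A) + H·g(A) = b'·D + f'(A) + H·g'(A) in R then b = b', f = f' and g = g'. -/

import Mathlib

noncomputable section

open MvPolynomial

abbrev PDab : Type := MvPolynomial (Fin 3) ℤ

/-- Relations `D² − 1`, `D·A − A`, `D·B − B`, `B² − 4(A − 2B)` with `D, A, B = X 0, X 1, X 2`. -/
def relsDAB : Set PDab :=
  {X 0 ^ 2 - 1, X 0 * X 1 - X 1, X 0 * X 2 - X 2, X 2 ^ 2 - 4 * (X 1 - 2 * X 2)}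

/-- The ring `ℤ[D,A,B]/(D²−1, D·A−A, D·B−B, B²−4(A−2B))`, i.e. `RO(Pin(2))`. -/
abbrev RO : Type := PDab ⧸ Ideal.span relsDAB

def Dv : RO := Ideal.Quotient.mk (Ideal.span relsDAB) (X 0)
def Av : RO := Ideal.Quotient.mk (Ideal.span relsDAB) (X 1)
def Bv : RO := Ideal.Quotient.mk (Ideal.span relsDAB) (X 2)

/-- The element `H = B + 2(1 + D)` of `R`. -/
def Hv : RO := Bv + 2 * (1 + Dv)

lemma rel_zero {p : PDab} (h : p ∈ relsDAB) :
    Ideal.Quotient.mk (Ideal.span relsDAB) p = 0 :=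
  Ideal.Quotient.eq_zero_iff_mem.2 (Ideal.subset_span h)

lemma D_sq : Dv * Dv = 1 := by
  have h := rel_zero (p := X 0 ^ 2 - 1) (by simp [relsDAB])
  simp only [map_sub, map_pow, map_one] at h
  change Dv ^ 2 - 1 = 0 at h
  linear_combination h

lemma D_A : Dv * Av = Av := by
  have h := rel_zero (p := X 0 * X 1 - X 1) (by simp [relsDAB])
  simp only [map_sub, map_mul] at h
  exact sub_eq_zero.1 h

lemma D_B : Dv * Bv = Bv := by
  have h := rel_zero (p := X 0 * X 2 - X 2) (by simp [relsDAB])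
  simp only [map_sub, map_mul] at h
  exact sub_eq_zero.1 h

lemma B_sq : Bv ^ 2 = 4 * (Av - 2 * Bv) := by
  have h := rel_zero (p := X 2 ^ 2 - 4 * (X 1 - 2 * X 2)) (by simp [relsDAB])
  simp only [map_sub, map_mul, map_pow, map_ofNat] at h
  exact sub_eq_zero.1 h

lemma D_f (f : Polynomial ℤ) : Dv * Polynomial.aeval Av f =
    (f.coeff 0 : RO) * Dv + Polynomial.aeval Av f - (f.coeff 0 : RO) := by
  have h : Polynomial.aeval Av f =
      Polynomial.aeval Av f.divX * Av + (f.coeff 0 : RO) := by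
    conv_lhs => rw [← Polynomial.divX_mul_X_add f]
    simp
  rw [h]
  linear_combination Polynomial.aeval Av f.divX * D_A

lemma exists_repr (x : RO) : ∃ (b : ℤ) (f g : Polynomial ℤ),
      x = (b : RO) * Dv + Polynomial.aeval Av f + Hv * Polynomial.aeval Av g := by
  obtain ⟨p, rfl⟩ := Ideal.Quotient.mk_surjective x
  induction p using MvPolynomial.induction_on with
  | C a => exact ⟨0, Polynomial.C a, 0, by simp⟩
  | add p q hp hq =>
    obtain ⟨b, f, g, h⟩ := hp
    obtain ⟨b', f', g', h'⟩ := hq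
    refine ⟨b + b', f + f', g + g', ?_⟩
    rw [map_add, h, h']
    simp only [map_add, Int.cast_add]
    ring
  | mul_X p i hp =>
    obtain ⟨b, f, g, h⟩ := hp
    rw [map_mul, h]
    have hf := D_f f
    have hg := D_f g
    fin_cases i
    · refine ⟨f.coeff 0, Polynomial.C b + f - Polynomial.C (f.coeff 0), g, ?_⟩
      change _ * Dv = _
      simp only [map_add, map_sub, Hv, eq_intCast, map_intCast]
      linear_combination hf + (b + 2 * Polynomial.aeval Av g) * D_sq +
        Polynomial.aeval Av g * D_B
    · refine ⟨0, Polynomial.C b * Polynomial.X + Polynomial.X * f, Polynomial.X * g, ?_⟩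
      change _ * Av = _
      simp only [map_add, map_mul, Polynomial.aeval_X, eq_intCast, map_intCast,
        Int.cast_zero]
      linear_combination (b : RO) * D_A
    · refine ⟨-2 * b - 2 * f.coeff 0 + 8 * g.coeff 0,
        -2 * Polynomial.C b - 4 * f + 2 * Polynomial.C (f.coeff 0)
          + (4 * Polynomial.X + 16) * g - 8 * Polynomial.C (g.coeff 0),
        Polynomial.C b + f - 4 * g, ?_⟩
      change _ * Bv = _
      simp only [map_add, map_sub, map_mul, map_neg, map_ofNat, 
        Polynomial.aeval_X, eq_intCast, map_intCast, Hv]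
      push_cast
      linear_combination (b : RO) * D_B - 2 * hf + 8 * hg + Polynomial.aeval Av g * B_sq
        + 2 * Polynomial.aeval Av g * D_B

lemma exists_hom {S : Type} [CommRing S] (d a c : S) (h1 : d ^ 2 = 1) (h2 : d * a = a)
    (h3 : d * c = c) (h4 : c ^ 2 = 4 * (a - 2 * c)) :
    ∃ φ : RO →+* S, φ Dv = d ∧ φ Av = a ∧ φ Bv = c := by
  refine ⟨Ideal.Quotient.lift (Ideal.span relsDAB)
    (MvPolynomial.eval₂Hom (Int.castRingHom S) ![d, a, c]) ?_, ?_, ?_, ?_⟩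
  · intro p hp
    rw [← RingHom.mem_ker]
    refine (Ideal.span_le.2 ?_) hp
    rintro q (rfl | rfl | rfl | rfl) <;>
      simp [RingHom.mem_ker, h1, h2, h3, h4]
  all_goals simp [Dv, Av, Bv]

lemma hom_aeval {S : Type} [CommRing S] (φ : RO →+* S) (f : Polynomial ℤ) :
    φ (Polynomial.aeval Av f) = Polynomial.aeval (φ Av) f := by
  simpa using (Polynomial.aeval_algHom_apply φ.toIntAlgHom Av f).symm

lemma hom_comp (φ : RO →+* Polynomial ℤ) (f : Polynomial ℤ) :
    φ (Polynomial.aeval Av f) = f.comp (φ Av) := by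
  induction f using Polynomial.induction_on' with
  | add p q hp hq => simp [hp, hq]
  | monomial n a => simp [Polynomial.aeval_monomial]

lemma comp_zero {f : Polynomial ℤ} (h : f.comp (Polynomial.X ^ 2 - 4) = 0) : f = 0 := by
  have hd : (Polynomial.X ^ 2 - 4 : Polynomial ℤ).natDegree = 2 := by
    have := Polynomial.natDegree_X_pow_sub_C (R := ℤ) (n := 2) (r := 4)
    simpa using this
  rcases Polynomial.comp_eq_zero_iff.1 h with h | ⟨_, h⟩
  · exact h
  · rw [h] at hd
    simp at hd

/-- Lemma 7.4(2). With `H = B + 2(1+D)`, every element `x` of `R` can be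
written uniquely as `x = b·D + f(A) + H·g(A)` with `b ∈ ℤ` and `f, g ∈ ℤ[t]`. -/
theorem unique_repr_D_A_H :
    (∀ x : RO, ∃ (b : ℤ) (f g : Polynomial ℤ),
      x = (b : RO) * Dv + Polynomial.aeval Av f + Hv * Polynomial.aeval Av g) ∧
    (∀ (b b' : ℤ) (f f' g g' : Polynomial ℤ),
      (b : RO) * Dv + Polynomial.aeval Av f + Hv * Polynomial.aeval Av g =
        (b' : RO) * Dv + Polynomial.aeval Av f' + Hv * Polynomial.aeval Av g' →
      b = b' ∧ f = f' ∧ g = g') := by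
  refine ⟨exists_repr, ?_⟩
  intro b b' f f' g g' h
  obtain ⟨φ, hD, hA, hB⟩ := exists_hom (1 : Polynomial ℤ) (Polynomial.X ^ 2 - 4)
    (2 * Polynomial.X - 4) (by ring) (by ring) (by ring) (by ring)
  obtain ⟨ψ, kD, kA, kB⟩ := exists_hom (-1 : ℤ) 0 0 (by ring) (by ring) (by ring) (by ring)
  have e1 := congrArg φ h
  have e2 := congrArg ψ h
  simp only [Hv, map_add, map_mul, map_intCast, map_ofNat, map_one, hom_comp, hD, hA, hB] at e1
  simp only [Hv, map_add, map_mul, map_intCast, map_ofNat, map_one, hom_aeval, kD, kA, kB] at e2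
  have e3 := congrArg (fun p : Polynomial ℤ => p.comp (-Polynomial.X)) e1
  simp only [Polynomial.add_comp, Polynomial.mul_comp, Polynomial.sub_comp, Polynomial.comp_assoc,
    Polynomial.pow_comp, Polynomial.X_comp, Polynomial.one_comp, Polynomial.intCast_comp,
    Polynomial.ofNat_comp, neg_sq] at e3
  have hg : g = g' := by
    rw [← sub_eq_zero]
    apply comp_zero
    rw [Polynomial.sub_comp]
    have h4 : (4 * Polynomial.X : Polynomial ℤ) *
        (g.comp (Polynomial.X ^ 2 - 4) - g'.comp (Polynomial.X ^ 2 - 4)) = 0 := by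
      linear_combination e1 - e3
    exact (mul_eq_zero.1 h4).resolve_left (by simp)
  subst hg
  have hf : f - f' + ((b - b' : ℤ) : Polynomial ℤ) = 0 := by
    apply comp_zero
    simp only [Polynomial.add_comp, Polynomial.sub_comp, Polynomial.intCast_comp]
    push_cast
    linear_combination e1
  have h0 := congrArg (Polynomial.aeval (0 : ℤ)) hf
  simp only [map_add, map_sub, map_intCast, map_zero, Int.cast_id] at h0
  simp only [Int.cast_id] at e2
  have hb : b = b' := by linarith
  subst hb
  refine ⟨rfl, ?_, rfl⟩
  simpa [sub_eq_zero] using hf
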